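/- Assume f is C² monostable with f'(0)=1, U_* the decreasing minimal wave of speed 2, and let r > 0 and h be C¹ with h'(t) = o(1/t) as t→+∞. Let δ ∈ (0,1/2) be such that f'(u) ≤ f'(1)/2 < 0 for all u ∈ [1−2δ, 1]. Then there exist γ > 0 and T > (1−δ)/γ such that, with Z_δ(t) defined by U_*(−Z_δ(t)) = 1 − δ − γ/t, the function ū₁(t,x) := U_*(x − 2t + r ln t − h(t)) + γ/t satisfies ∂_t ū₁ − ∂_xx ū₁ − f(ū₁) ≥ 0 for all t ≥ T and all x ≤ 2t − r ln t + h(t) − Z_δ(t). -/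

import Mathlib

open Real Filter Set

/-- A strictly antitone function on `ℝ` tending to `a` at `-∞` and to `b` at `+∞` takes its values
in `(b, a)`. -/
lemma StrictAnti.mem_Ioo_of_tendsto {U : ℝ → ℝ} {a b : ℝ} (hU : StrictAnti U)
    (ha : Tendsto U atBot (nhds a)) (hb : Tendsto U atTop (nhds b)) (z : ℝ) :
    U z ∈ Ioo b a :=
  ⟨(hU.antitone.le_of_tendsto hb (z + 1)).trans_lt (hU (by linarith)),
    (hU (by linarith)).trans_le (hU.antitone.ge_of_tendsto ha (z - 1))⟩

/-- An antitone function satisfying `U'' + 2 U' < 0` at a point (in the sense of `deriv`) has a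
negative derivative there; in particular it is differentiable at that point. -/
lemma Antitone.deriv_neg_of_deriv_deriv_add_neg {U : ℝ → ℝ} (hU : Antitone U) {z : ℝ}
    (hz : deriv (deriv U) z + 2 * deriv U z < 0) : deriv U z < 0 := by
  refine lt_of_le_of_ne hU.deriv_nonpos fun h0 => ?_
  have hmax : IsLocalMax (deriv U) z :=
    Eventually.of_forall fun y => h0 ▸ hU.deriv_nonpos
  rw [hmax.deriv_eq_zero, h0] at hz
  norm_num at hz

/-- A differentiable function with values in an interval of length one whose second derivative is
positive wherever the first one is equal to a constant `-B ≤ -1` has first derivative at least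
`-B`. -/
lemma neg_le_deriv_of_deriv_deriv_pos {U : ℝ → ℝ} {B : ℝ} (hU : Differentiable ℝ U)
    (hosc : ∀ x y, U x - U y < 1) (hB : 1 ≤ B)
    (hpos : ∀ z, deriv U z = -B → 0 < deriv (deriv U) z) (z : ℝ) : -B ≤ deriv U z := by
  by_contra! hz
  set φ : ℝ → ℝ := fun x => U x + B * x with hφ
  have hφd : ∀ x, HasDerivAt φ (deriv U x + B) x := fun x =>
    ((hU x).hasDerivAt.add ((hasDerivAt_id x).const_mul B)).congr_deriv (by rw [mul_one])
  have hφ' : deriv φ = fun x => deriv U x + B := funext fun x => (hφd x).deriv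
  have hφc : Continuous φ := continuous_iff_continuousAt.2 fun x => (hφd x).continuousAt
  obtain ⟨m, hm, hmax⟩ := isCompact_Icc.exists_isMaxOn
    (nonempty_Icc.2 (sub_le_self z zero_le_one)) hφc.continuousOn
  have hleft : m ≠ z - 1 := by
    rintro rfl
    have h1 : φ z ≤ φ (z - 1) := hmax (right_mem_Icc.2 (by linarith))
    have h2 := hosc (z - 1) z
    simp only [hφ] at h1
    linarith
  have hright : m ≠ z := by
    rintro rfl
    have hslope := (hasDerivAt_iff_tendsto_slope_left_right.1 (hφd m)).1
    have hneg := hslope.eventually_lt_const (show deriv U m + B < 0 by linarith)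
    obtain ⟨y, hy, hy'⟩ := (hneg.and
      (Ioo_mem_nhdsLT (show m - 1 < m by linarith))).exists
    have h1 : φ y ≤ φ m := hmax (Ioo_subset_Icc_self hy')
    rw [slope_def_field] at hy
    exact hy.not_ge (div_nonneg_of_nonpos (by linarith) (by linarith [hy'.2]))
  have hloc : IsLocalMax φ m := hmax.isLocalMax
    (Icc_mem_nhds (lt_of_le_of_ne hm.1 hleft.symm) (lt_of_le_of_ne hm.2 hright))
  have hd := hloc.deriv_eq_zero
  have hdd : 0 < deriv (deriv φ) m := by
    rw [hφ', deriv_add_const]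
    rw [hφ'] at hd
    exact hpos m (by linarith)
  have hloc' := isLocalMin_of_deriv_deriv_pos hdd hd hφc.continuousAt
  have hconst : φ =ᶠ[nhds m] fun _ => φ m := by
    filter_upwards [hloc, hloc'] with y h1 h2 using le_antisymm h1 h2
  have h0 := hconst.deriv.deriv_eq
  simp at h0
  exact hdd.ne' h0

/-- Lemma 4.6: the shifted wave plus `γ/t` is a supersolution
on the left region `x ≤ 2t − r ln t + h(t) − Z_δ(t)`. -/
theorem statement_11
    (f : ℝ → ℝ) (hf : ContDiff ℝ 2 f)
    (hf0 : f 0 = 0) (hf1 : f 1 = 0)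
    (hf'0 : deriv f 0 = 1) (hf'1 : deriv f 1 < 0)
    (hfpos : ∀ s ∈ Set.Ioo (0:ℝ) 1, 0 < f s)
    (Ustar : ℝ → ℝ)
    (hUstar_anti : StrictAnti Ustar)
    (hUstar_ode : ∀ z,
      deriv (deriv Ustar) z + 2 * deriv Ustar z + f (Ustar z) = 0)
    (hUstar_limbot : Tendsto Ustar atBot (nhds 1))
    (hUstar_limtop : Tendsto Ustar atTop (nhds 0))
    (r : ℝ) (hr : 0 < r)
    (h : ℝ → ℝ) (hhC1 : ContDiff ℝ 1 h)
    (hh' : deriv h =o[atTop] fun t => 1 / t)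
    (δ : ℝ) (hδ : δ ∈ Set.Ioo (0:ℝ) (1/2))
    (hδf : ∀ u ∈ Set.Icc (1 - 2 * δ) 1, deriv f u ≤ deriv f 1 / 2) :
    ∃ γ > (0:ℝ), ∃ T > (1 - δ) / γ, ∃ Zδ : ℝ → ℝ,
      (∀ t ≥ T, Ustar (-(Zδ t)) = 1 - δ - γ / t) ∧
      ∀ u1 : ℝ → ℝ → ℝ,
        (∀ t x : ℝ, u1 t x =
          Ustar (x - 2 * t + r * Real.log t - h t) + γ / t) →
        ∀ t ≥ T, ∀ x ≤ 2 * t - r * Real.log t + h t - Zδ t,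
          0 ≤ deriv (fun s => u1 s x) t - deriv (deriv (fun y => u1 t y)) x
            - f (u1 t x) := by
  have hU01 : ∀ z, Ustar z ∈ Ioo (0 : ℝ) 1 :=
    hUstar_anti.mem_Ioo_of_tendsto hUstar_limbot hUstar_limtop
  have hU'neg : ∀ z, deriv Ustar z < 0 := fun z =>
    hUstar_anti.antitone.deriv_neg_of_deriv_deriv_add_neg
      (by linarith [hUstar_ode z, hfpos _ (hU01 z)])
  have hUdiff : Differentiable ℝ Ustar := fun z =>
    differentiableAt_of_deriv_ne_zero (hU'neg z).ne
  have hfdiff : Differentiable ℝ f := hf.differentiable (by norm_num)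
  obtain ⟨M, hM⟩ := (isCompact_Icc (a := (0 : ℝ)) (b := 1)).bddAbove_image
    hf.continuous.continuousOn
  have hfM : ∀ z, f (Ustar z) ≤ M := fun z =>
    hM ⟨_, Ioo_subset_Icc_self (hU01 z), rfl⟩
  obtain ⟨K, hK1, hK⟩ : ∃ K : ℝ, 1 ≤ K ∧ ∀ z, -K ≤ deriv Ustar z := by
    refine ⟨max 1 M, le_max_left _ _, neg_le_deriv_of_deriv_deriv_pos hUdiff
      (fun x y => by linarith [(hU01 x).2, (hU01 y).1]) (le_max_left _ _) fun z hz => ?_⟩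
    have h1 := hUstar_ode z
    rw [hz] at h1
    linarith [hfM z, le_max_left 1 M, le_max_right 1 M]
  obtain ⟨a, ha⟩ : ∃ a, a = -deriv f 1 := ⟨_, rfl⟩
  have ha0 : 0 < a := by linarith
  obtain ⟨ε, hε, hfε⟩ : ∃ ε > 0, ∀ u, |u - 1| < ε → deriv f u < -(a / 4) := by
    have hc : Continuous (deriv f) := hf.continuous_deriv (by norm_num)
    exact Metric.eventually_nhds_iff.1
      (hc.continuousAt.eventually_lt_const (show deriv f 1 < -(a / 4) by linarith))
  obtain ⟨γ, hγ⟩ : ∃ γ, γ = 16 * r * K / a := ⟨_, rfl⟩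
  have hγ0 : 0 < γ := by rw [hγ]; positivity
  have hγt : Tendsto (fun t : ℝ => γ / t) atTop (nhds 0) := tendsto_const_nhds.div_atTop tendsto_id
  obtain ⟨T₀, hT₀⟩ := eventually_atTop.1 ((hh'.def hr).and
    ((hγt.eventually_lt_const hε).and ((hγt.eventually_lt_const hδ.1).and
      ((eventually_ge_atTop (8 / a)).and (eventually_gt_atTop 0)))))
  have hZ : ∀ t, ∃ z, max T₀ ((1 - δ) / γ + 1) ≤ t → Ustar (-z) = 1 - δ - γ / t := by
    intro t
    by_cases ht : max T₀ ((1 - δ) / γ + 1) ≤ t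
    · obtain ⟨-, -, h2, -, h0⟩ := hT₀ t ((le_max_left _ _).trans ht)
      have hp : 0 < γ / t := div_pos hγ0 h0
      obtain ⟨z, hz⟩ := mem_range_of_exists_le_of_exists_ge hUdiff.continuous
        (((hUstar_limtop.eventually_le_const
          (show (0 : ℝ) < 1 - δ - γ / t by linarith [hδ.2])).exists))
        ((hUstar_limbot.eventually_const_le
          (show 1 - δ - γ / t < 1 by linarith [hδ.1])).exists)
      exact ⟨-z, fun _ => by rw [neg_neg, hz]⟩
    · exact ⟨0, fun h => absurd h ht⟩
  choose Zδ hZδ using hZ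
  refine ⟨γ, hγ0, max T₀ ((1 - δ) / γ + 1), lt_max_of_lt_right (lt_add_one _), Zδ, hZδ, ?_⟩
  intro u1 hu1 t ht x hx
  obtain ⟨hh't, hγε, hγδ, h8, ht0⟩ := hT₀ t ((le_max_left _ _).trans ht)
  obtain ⟨z, hz⟩ : ∃ z, z = x - 2 * t + r * Real.log t - h t := ⟨_, rfl⟩
  have htime : deriv (fun s => u1 s x) t
      = deriv Ustar z * (-2 + r / t - deriv h t) - γ / t ^ 2 := by
    have hlog := (Real.hasDerivAt_log ht0.ne').const_mul r
    have hhd := ((hhC1.differentiable (by norm_num)) t).hasDerivAt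
    have hin := ((((hasDerivAt_id t).const_mul 2).const_sub x).add hlog).sub hhd
    have hUd : HasDerivAt Ustar (deriv Ustar z) (x - 2 * t + r * Real.log t - h t) :=
      hz ▸ (hUdiff z).hasDerivAt
    have hγd := (hasDerivAt_inv ht0.ne').const_mul γ
    have hfun : (fun s => u1 s x)
        = fun s => Ustar (x - 2 * s + r * Real.log s - h s) + γ * s⁻¹ := by
      funext s
      rw [hu1, div_eq_mul_inv]
    rw [hfun]
    refine (((HasDerivAt.comp t hUd hin).add hγd).congr_deriv ?_).deriv
    field_simp
    ring
  have hspace : deriv (deriv (fun y => u1 t y)) x = deriv (deriv Ustar) z := by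
    have hfun : (fun y => u1 t y)
        = fun y => Ustar (y - (2 * t - r * Real.log t + h t)) + γ / t := by
      funext y
      rw [hu1]
      congr 2
      ring
    have hfun' : deriv (fun y => u1 t y)
        = fun y => deriv Ustar (y - (2 * t - r * Real.log t + h t)) := by
      funext y
      rw [hfun, deriv_add_const, deriv_comp_sub_const]
    rw [hfun', deriv_comp_sub_const]
    congr 1
    rw [hz]
    ring
  have hu : u1 t x = Ustar z + γ / t := by rw [hu1, hz]
  have hp : 0 < γ / t := div_pos hγ0 ht0
  have hUz : 1 - 2 * δ ≤ Ustar z := by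
    have h1 := hUstar_anti.antitone (show z ≤ -Zδ t by linarith)
    rw [hZδ t ht] at h1
    linarith
  have hreact : f (Ustar z + γ / t) - f (Ustar z) ≤ -(a / 4) * (γ / t) := by
    have hle : ∀ u ∈ interior (Icc (Ustar z) (Ustar z + γ / t)), deriv f u ≤ -(a / 4) := by
      rw [interior_Icc]
      intro u hu
      rcases le_total u 1 with hu1 | hu1
      · linarith [hδf u ⟨hUz.trans hu.1.le, hu1⟩]
      · refine (hfε u ?_).le
        rw [abs_of_nonneg (by linarith)]
        linarith [hu.2, (hU01 z).2]
    simpa using (convex_Icc _ _).image_sub_le_mul_sub_of_deriv_le hfdiff.continuous.continuousOn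
      hfdiff.differentiableOn hle _ (left_mem_Icc.2 (by linarith)) _
      (right_mem_Icc.2 (by linarith)) (by linarith)
  have hdrift : -(a / 8) * (γ / t) ≤ deriv Ustar z * (r / t - deriv h t) := by
    have habs : |deriv h t| ≤ r / t := by
      simpa [abs_of_pos ht0, div_eq_mul_inv] using hh't
    obtain ⟨hlo, hhi⟩ := abs_le.1 habs
    have heq : a / 8 * (γ / t) = K * (2 * (r / t)) := by
      rw [hγ]
      field_simp
      norm_num
    calc -(a / 8) * (γ / t) = -K * (2 * (r / t)) := by linarith
      _ ≤ -K * (r / t - deriv h t) :=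
        mul_le_mul_of_nonpos_left (by linarith) (by linarith)
      _ ≤ deriv Ustar z * (r / t - deriv h t) :=
        mul_le_mul_of_nonneg_right (hK z) (by linarith)
  have hsq : γ / t ^ 2 ≤ a / 8 * (γ / t) := by
    have h1 : 1 / t ≤ a / 8 := by
      rw [div_le_iff₀ ht0]
      rw [div_le_iff₀ ha0] at h8
      linarith
    calc γ / t ^ 2 = 1 / t * (γ / t) := by field_simp
      _ ≤ a / 8 * (γ / t) := mul_le_mul_of_nonneg_right h1 hp.le
  rw [htime, hspace, hu]
  linarith [hUstar_ode z]
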